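/- arXiv:2406.14945 — 4 statements merged into one kernel-verified Lean document; each statement's English description precedes it below -/
import Mathlib

section
/- Let Q = diag(1,1,-1) ∈ M₃(ℂ) and H := {(X₊, X₋) ∈ GL(3,ℂ) × GL(3,ℂ) : X₊ᵀ Q X₋ = Q and X₋ᵀ Q X₊ = Q}. Then every (X₊, X₋) ∈ H satisfies det X₋ = (det X₊)⁻¹, and the isomorphism Φ : A ↦ (A, Q (A⁻¹)ᵀ Q) restricts to a group isomorphism of SL(3,ℂ) = {A ∈ GL(3,ℂ) : det A = 1} onto {(X₊, X₋) ∈ H : det X₊ = 1 and det X₋ = 1}. -/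
open Matrix

noncomputable def Qmat : Matrix (Fin 3) (Fin 3) ℂ := Matrix.diagonal ![1, 1, -1]

/-- The set `H` of pairs `(X₊, X₋)` of invertible complex matrices with
`X₊ᵀ Q X₋ = Q` and `X₋ᵀ Q X₊ = Q` (the group `U(2,1,ℂ_τ)` in idempotent coordinates). -/
def Hset : Set (GL (Fin 3) ℂ × GL (Fin 3) ℂ) :=
  {p | (p.1 : Matrix (Fin 3) (Fin 3) ℂ)ᵀ * Qmat * (p.2 : Matrix (Fin 3) (Fin 3) ℂ) = Qmat ∧
       (p.2 : Matrix (Fin 3) (Fin 3) ℂ)ᵀ * Qmat * (p.1 : Matrix (Fin 3) (Fin 3) ℂ) = Qmat}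

theorem Qmat_mul_self : Qmat * Qmat = 1 := by
  unfold Qmat
  rw [Matrix.diagonal_mul_diagonal, ← Matrix.diagonal_one]
  congr 1
  funext i
  fin_cases i <;> simp

theorem Qmat_transpose : Qmatᵀ = Qmat := by
  unfold Qmat
  exact Matrix.diagonal_transpose _

theorem Qmat_conj (X Y : Matrix (Fin 3) (Fin 3) ℂ) :
    (Qmat * X * Qmat) * (Qmat * Y * Qmat) = Qmat * (X * Y) * Qmat := by
  calc _ = Qmat * X * (Qmat * Qmat) * Y * Qmat := by simp only [Matrix.mul_assoc]
    _ = _ := by rw [Qmat_mul_self]; simp only [Matrix.mul_assoc, Matrix.one_mul]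

theorem SL_inv_mul (A : Matrix.SpecialLinearGroup (Fin 3) ℂ) :
    ((A⁻¹ : Matrix.SpecialLinearGroup (Fin 3) ℂ) : Matrix (Fin 3) (Fin 3) ℂ) *
      (A : Matrix (Fin 3) (Fin 3) ℂ) = 1 := by
  rw [← Matrix.SpecialLinearGroup.coe_mul, inv_mul_cancel, Matrix.SpecialLinearGroup.coe_one]

theorem SL_mul_inv (A : Matrix.SpecialLinearGroup (Fin 3) ℂ) :
    (A : Matrix (Fin 3) (Fin 3) ℂ) *
    ((A⁻¹ : Matrix.SpecialLinearGroup (Fin 3) ℂ) : Matrix (Fin 3) (Fin 3) ℂ) = 1 := by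
  rw [← Matrix.SpecialLinearGroup.coe_mul, mul_inv_cancel, Matrix.SpecialLinearGroup.coe_one]

noncomputable def Phi2 (A : Matrix.SpecialLinearGroup (Fin 3) ℂ) : GL (Fin 3) ℂ where
  val := Qmat * ((A⁻¹ : Matrix.SpecialLinearGroup (Fin 3) ℂ) : Matrix (Fin 3) (Fin 3) ℂ)ᵀ * Qmat
  inv := Qmat * (A : Matrix (Fin 3) (Fin 3) ℂ)ᵀ * Qmat
  val_inv := by
    rw [Qmat_conj, ← Matrix.transpose_mul, SL_mul_inv, Matrix.transpose_one, Matrix.mul_one,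
      Qmat_mul_self]
  inv_val := by
    rw [Qmat_conj, ← Matrix.transpose_mul, SL_inv_mul, Matrix.transpose_one, Matrix.mul_one,
      Qmat_mul_self]

noncomputable def PhiHom :
    Matrix.SpecialLinearGroup (Fin 3) ℂ →* GL (Fin 3) ℂ × GL (Fin 3) ℂ :=
  MonoidHom.mk' (fun A => (Matrix.SpecialLinearGroup.toGL A, Phi2 A)) (by
    intro A B
    refine Prod.ext (map_mul _ A B) (Units.ext ?_)
    change Qmat * (((A * B)⁻¹ : Matrix.SpecialLinearGroup (Fin 3) ℂ) :
      Matrix (Fin 3) (Fin 3) ℂ)ᵀ * Qmat = (Qmat * _ * Qmat) * (Qmat * _ * Qmat)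
    rw [Qmat_conj, ← Matrix.transpose_mul, _root_.mul_inv_rev, Matrix.SpecialLinearGroup.coe_mul])

theorem Hset_det (p : GL (Fin 3) ℂ × GL (Fin 3) ℂ) (hp : p ∈ Hset) :
    Matrix.det (p.1 : Matrix (Fin 3) (Fin 3) ℂ) *
      Matrix.det (p.2 : Matrix (Fin 3) (Fin 3) ℂ) = 1 := by
  have h := congrArg Matrix.det hp.1
  have hq := congrArg Matrix.det Qmat_mul_self
  rw [Matrix.det_mul, Matrix.det_mul, Matrix.det_transpose] at h
  rw [Matrix.det_mul, Matrix.det_one] at hq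
  linear_combination (Qmat.det) * h + (1 - p.1.val.det * p.2.val.det) * hq

theorem Phi_mem (A : Matrix.SpecialLinearGroup (Fin 3) ℂ) : PhiHom A ∈ Hset := by
  constructor
  · change (A : Matrix (Fin 3) (Fin 3) ℂ)ᵀ * Qmat * (Qmat *
      ((A⁻¹ : Matrix.SpecialLinearGroup (Fin 3) ℂ) : Matrix (Fin 3) (Fin 3) ℂ)ᵀ * Qmat) = Qmat
    calc _ = (A : Matrix (Fin 3) (Fin 3) ℂ)ᵀ * (Qmat * Qmat) *
      ((A⁻¹ : Matrix.SpecialLinearGroup (Fin 3) ℂ) : Matrix (Fin 3) (Fin 3) ℂ)ᵀ * Qmat := by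
          simp only [Matrix.mul_assoc]
      _ = _ := by
        rw [Qmat_mul_self, Matrix.mul_one, ← Matrix.transpose_mul, SL_inv_mul,
          Matrix.transpose_one, Matrix.one_mul]
  · change (Qmat * ((A⁻¹ : Matrix.SpecialLinearGroup (Fin 3) ℂ) :
      Matrix (Fin 3) (Fin 3) ℂ)ᵀ * Qmat)ᵀ * Qmat * (A : Matrix (Fin 3) (Fin 3) ℂ) = Qmat
    rw [Matrix.transpose_mul, Matrix.transpose_mul, Matrix.transpose_transpose, Qmat_transpose]
    calc _ = Qmat * ((A⁻¹ : Matrix.SpecialLinearGroup (Fin 3) ℂ) : Matrix (Fin 3) (Fin 3) ℂ) *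
        (Qmat * Qmat) * (A : Matrix (Fin 3) (Fin 3) ℂ) := by simp only [Matrix.mul_assoc]
      _ = _ := by
        rw [Qmat_mul_self, Matrix.mul_one, Matrix.mul_assoc, SL_inv_mul, Matrix.mul_one]

theorem Hset_snd_unique (a b c : GL (Fin 3) ℂ) (h1 : (a, b) ∈ Hset) (h2 : (a, c) ∈ Hset) :
    b = c := by
  have h : (a : Matrix (Fin 3) (Fin 3) ℂ)ᵀ * Qmat * (b : Matrix (Fin 3) (Fin 3) ℂ) =
      (a : Matrix (Fin 3) (Fin 3) ℂ)ᵀ * Qmat * (c : Matrix (Fin 3) (Fin 3) ℂ) :=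
    h1.1.trans h2.1.symm
  have ha : Qmat * (a⁻¹ : GL (Fin 3) ℂ).valᵀ * (a.valᵀ * Qmat) = 1 := by
    calc _ = Qmat * ((a⁻¹ : GL (Fin 3) ℂ).valᵀ * a.valᵀ) * Qmat := by
          simp only [Matrix.mul_assoc]
      _ = 1 := by
        rw [← Matrix.transpose_mul, Units.mul_inv, Matrix.transpose_one, Matrix.mul_one,
          Qmat_mul_self]
  apply Units.ext
  have h' := congrArg (fun M => Qmat * (a⁻¹ : GL (Fin 3) ℂ).valᵀ * M) h
  simpa only [← Matrix.mul_assoc _ (a.valᵀ * Qmat), ha, Matrix.one_mul] using h'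

theorem stmt_1 :
    (∀ p ∈ Hset,
      Matrix.det (p.2 : Matrix (Fin 3) (Fin 3) ℂ) = (Matrix.det (p.1 : Matrix (Fin 3) (Fin 3) ℂ))⁻¹) ∧
    ∃ Φ : Matrix.SpecialLinearGroup (Fin 3) ℂ →* GL (Fin 3) ℂ × GL (Fin 3) ℂ,
      Function.Injective Φ ∧
      (∀ A : Matrix.SpecialLinearGroup (Fin 3) ℂ,
        ((Φ A).1 : Matrix (Fin 3) (Fin 3) ℂ) = (A : Matrix (Fin 3) (Fin 3) ℂ) ∧
        ((Φ A).2 : Matrix (Fin 3) (Fin 3) ℂ) =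
          Qmat * ((A⁻¹ : Matrix.SpecialLinearGroup (Fin 3) ℂ) : Matrix (Fin 3) (Fin 3) ℂ)ᵀ * Qmat) ∧
      Set.range Φ =
        {p | p ∈ Hset ∧ Matrix.det (p.1 : Matrix (Fin 3) (Fin 3) ℂ) = 1 ∧
             Matrix.det (p.2 : Matrix (Fin 3) (Fin 3) ℂ) = 1} := by
  refine ⟨fun p hp => eq_inv_of_mul_eq_one_right (Hset_det p hp), PhiHom, ?_,
    fun A => ⟨rfl, rfl⟩, ?_⟩
  · intro A B h
    apply Subtype.ext
    exact congrArg (fun p : GL (Fin 3) ℂ × GL (Fin 3) ℂ => p.1.val) h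
  · ext p
    constructor
    · rintro ⟨A, rfl⟩
      have h1 : Matrix.det ((PhiHom A).1 : Matrix (Fin 3) (Fin 3) ℂ) = 1 := A.2
      refine ⟨Phi_mem A, h1, ?_⟩
      have h := Hset_det _ (Phi_mem A)
      rwa [h1, one_mul] at h
    · rintro ⟨hp, h1, -⟩
      obtain ⟨a, b⟩ := p
      refine ⟨⟨a.val, h1⟩, ?_⟩
      have e : (PhiHom ⟨a.val, h1⟩).1 = a := Units.ext rfl
      refine Prod.ext e (Hset_snd_unique a _ _ ?_ hp)
      have := Phi_mem ⟨a.val, h1⟩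
      rwa [← Prod.mk.eta (p := PhiHom ⟨a.val, h1⟩), e] at this
end

section
/- Let V be a complex vector space, g : V × V → ℂ a symmetric ℂ-bilinear form, and P : V → V a ℂ-linear map with P∘P = id and g(Pu,Pv) = −g(u,v) for all u,v ∈ V, and let k ∈ ℂ. Let R : V⁴ → ℂ be ℂ-multilinear satisfying, for all X,Y,Z,W ∈ V: R(X,Y,Z,W) = −R(Y,X,Z,W) = −R(X,Y,W,Z); R(X,Y,Z,W) = R(Z,W,X,Y); the first Bianchi identity R(X,Y,Z,W) + R(Y,Z,X,W) + R(Z,X,Y,W) = 0; and R(PX,PY,Z,W) = −R(X,Y,Z,W) = R(X,Y,PZ,PW)·(−1)⁰, i.e. R(X,Y,PZ,PW) = −R(X,Y,Z,W). If R(X,PX,X,PX) = k·g(X,X)² for all X ∈ V, then for all X,Y,Z,W ∈ V: R(X,Y,Z,W) = −(k/4)·( g(X,Z)g(Y,W) − g(Y,Z)g(X,W) + g(X,PZ)g(PY,W) − g(Y,PZ)g(PX,W) + 2 g(X,PY)g(PZ,W) ). -/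
theorem aux_zero {V : Type*} [AddCommGroup V] (P : V → V) (hP : ∀ v, P (P v) = v)
    (Pa : ∀ u v, P (u + v) = P u + P v) (Pn : ∀ u, P (-u) = - P u)
    (S : V → V → V → V → ℂ)
    (a1 : ∀ X X' Y Z W, S (X + X') Y Z W = S X Y Z W + S X' Y Z W)
    (n1 : ∀ X Y Z W, S (-X) Y Z W = - S X Y Z W)
    (h1 : ∀ X Y Z W, S X Y Z W = - S Y X Z W)
    (h2 : ∀ X Y Z W, S X Y Z W = S Z W X Y)
    (h3 : ∀ X Y Z W, S X Y Z W + S Y Z X W + S Z X Y W = 0)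
    (h4 : ∀ X Y Z W, S (P X) (P Y) Z W = - S X Y Z W)
    (hsec : ∀ X, S X (P X) X (P X) = 0) : ∀ X Y Z W, S X Y Z W = 0 := by
  have h1' : ∀ X Y Z W, S X Y Z W = - S X Y W Z := fun X Y Z W => by
    rw [h2, h1, h2 W Z]
  have a2 : ∀ X Y Y' Z W, S X (Y + Y') Z W = S X Y Z W + S X Y' Z W := fun X Y Y' Z W => by
    rw [h1, a1, h1 X Y, h1 X Y']; ring
  have a3 : ∀ X Y Z Z' W, S X Y (Z + Z') W = S X Y Z W + S X Y Z' W := fun X Y Z Z' W => by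
    rw [h2, a1, h2 X Y Z, h2 X Y Z']
  have a4 : ∀ X Y Z W W', S X Y Z (W + W') = S X Y Z W + S X Y Z W' := fun X Y Z W W' => by
    rw [h2, a2, h2 X Y Z W, h2 X Y Z W']
  have n2 : ∀ X Y Z W, S X (-Y) Z W = - S X Y Z W := fun X Y Z W => by
    rw [h1, n1, h1 X Y]
  have n3 : ∀ X Y Z W, S X Y (-Z) W = - S X Y Z W := fun X Y Z W => by
    rw [h2, n1, h2 X Y]
  have n4 : ∀ X Y Z W, S X Y Z (-W) = - S X Y Z W := fun X Y Z W => by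
    rw [h2, n2, h2 X Y]
  have f1 : ∀ X Y Z W, S Y (P X) Z W = S X (P Y) Z W := fun X Y Z W => by
    have := h4 X (P Y) Z W
    rw [hP] at this
    rw [h1, this]; ring
  have f2 : ∀ X Y Z W, S X Y W (P Z) = S X Y Z (P W) := fun X Y Z W => by
    rw [h2, f1, h2]
  have h4' : ∀ X Y Z W, S X Y (P Z) (P W) = - S X Y Z W := fun X Y Z W => by
    rw [h2, h4, h2]
  have pol : ∀ X Y, 2 * S X (P Y) X (P Y) + S X (P X) Y (P Y) = 0 := fun X Y => by
    have e1 := hsec (X + Y)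
    have e2 := hsec (X + -Y)
    simp only [Pa, Pn, a1, a2, a3, a4, n1, n2, n3, n4, hsec] at e1 e2
    have q1 := f1 X Y X (P Y)
    have q2 := f1 X Y Y (P X)
    have q3 := f2 X (P Y) X Y
    have q4 := h2 X (P X) Y (P Y)
    linear_combination (e1 + e2) / 4 - (1/2) * q1 - (1/2) * q2 - q3 + (1/2) * q4
  have key : ∀ X Y, S X Y X Y = 3 * S X (P Y) X (P Y) := fun X Y => by
    have b := h3 X (P X) Y (P Y)
    have q1 := h1 (P X) Y X (P Y)
    have q2 := f1 X Y X (P Y)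
    have q3 := h4' Y X X Y
    have q3' := f2 Y X X Y
    have q4 := h4' Y X X Y
    have q5 := h1 Y X X Y
    have p := pol X Y
    linear_combination b - p - q1 + q2 - q3 + q5
  have z : ∀ X Y, S X Y X Y = 0 := fun X Y => by
    have e1 := key X Y
    have e2 := key X (P Y)
    rw [hP] at e2
    linear_combination (-1/8) * e1 - (3/8) * e2
  have z2 : ∀ X Y W, S X Y X W = 0 := fun X Y W => by
    have e := z X (Y + W)
    simp only [a2, a4, z] at e
    have := h2 X Y X W
    linear_combination e / 2 + this / 2
  have z3 : ∀ X Y Z W, S X Y Z W = - S Z Y X W := fun X Y Z W => by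
    have e := z2 (X + Z) Y W
    simp only [a1, a3, z2] at e
    linear_combination e
  intro X Y Z W
  have b := h3 X Y Z W
  have c1 := z3 X Y Z W
  have c2 := h1 Z Y X W
  have c3 := z3 Z X Y W
  have c4 := h1 Y X Z W
  linear_combination (b + c1 - c2 - c3 + c4) / 3

/-- A ℂ-multilinear (4,0)-tensor with the symmetries of the Riemann tensor of a complex
para-Hermitian structure, anti-invariant under the para-complex structure `P`, and with
constant para-holomorphic sectional curvature `k`, is given by the displayed formula. -/
theorem stmt_5 {V : Type*} [AddCommGroup V] [Module ℂ V]
    (g : V →ₗ[ℂ] V →ₗ[ℂ] ℂ) (hg : ∀ x y, g x y = g y x)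
    (P : V →ₗ[ℂ] V) (hP : ∀ v, P (P v) = v)
    (hPg : ∀ u v, g (P u) (P v) = - g u v) (k : ℂ)
    (R : V →ₗ[ℂ] V →ₗ[ℂ] V →ₗ[ℂ] V →ₗ[ℂ] ℂ)
    (h1 : ∀ X Y Z W, R X Y Z W = - R Y X Z W)
    (h1' : ∀ X Y Z W, R X Y Z W = - R X Y W Z)
    (h2 : ∀ X Y Z W, R X Y Z W = R Z W X Y)
    (h3 : ∀ X Y Z W, R X Y Z W + R Y Z X W + R Z X Y W = 0)
    (h4 : ∀ X Y Z W, R (P X) (P Y) Z W = - R X Y Z W)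
    (h4' : ∀ X Y Z W, R X Y (P Z) (P W) = - R X Y Z W)
    (hsec : ∀ X, R X (P X) X (P X) = k * (g X X) ^ 2) :
    ∀ X Y Z W, R X Y Z W =
      -(k / 4) * (g X Z * g Y W - g Y Z * g X W + g X (P Z) * g (P Y) W
        - g Y (P Z) * g (P X) W + 2 * g X (P Y) * g (P Z) W) := by
  intro X Y Z W
  have hw : ∀ u v, g (P u) v = - g u (P v) := fun u v => by
    have := hPg u (P v)
    rwa [hP] at this
  have hs : ∀ u v, g u (P v) = - g v (P u) := fun u v => by
    rw [hg, hw]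
  have := aux_zero P hP (map_add P) (map_neg P)
    (fun X Y Z W => R X Y Z W +
      (k / 4) * (g X Z * g Y W - g Y Z * g X W - g X (P Z) * g Y (P W)
        + g Y (P Z) * g X (P W) - 2 * g X (P Y) * g Z (P W)))
    ?_ ?_ ?_ ?_ ?_ ?_ ?_ X Y Z W
  · simp only [hw]
    linear_combination this
  · intro X X' Y Z W
    simp only [map_add, LinearMap.add_apply]
    ring
  · intro X Y Z W
    simp only [map_neg, LinearMap.neg_apply]
    ring
  · intro X Y Z W
    rw [h1 X Y, hs X Y]
    ring
  · intro X Y Z W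
    rw [h2 X Y, hg Z X, hg W Y, hg W X, hg Z Y, hs Z X, hs W Y, hs W X, hs Z Y]
    ring
  · intro X Y Z W
    rw [hg Z X, hg Y X, hg Z Y, hs Y X, hs Z X, hs Z Y]
    linear_combination h3 X Y Z W
  · intro X Y Z W
    simp only [h4, hw, hP]
    ring
  · intro X
    have e : g X (P X) = 0 := by
      have := hs X X
      linear_combination this / 2
    simp only [hsec, hw, hP, e]
    ring
end

section
/- Let V be a 4-dimensional complex vector space, g : V × V → ℂ a nondegenerate symmetric ℂ-bilinear form, and P : V → V a ℂ-linear map with P∘P = id and g(Pu,Pv) = −g(u,v) for all u,v ∈ V. Let D₊ := ker(P − id) and D₋ := ker(P + id). Let W ⊆ V be a 2-dimensional subspace satisfying the Lagrangian condition g(u, Pv) = 0 for all u,v ∈ W. Then the restriction of g to W is nondegenerate if and only if W ∩ D₊ = {0} and W ∩ D₋ = {0}. -/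
/-- A 2-dimensional Lagrangian subspace `W` of a 4-dimensional complex vector space with a
nondegenerate symmetric bilinear form `g` and a para-complex anti-isometry `P` has
nondegenerate induced form iff it is transverse to both eigenspaces of `P`. -/
theorem stmt_6 {V : Type*} [AddCommGroup V] [Module ℂ V] [FiniteDimensional ℂ V]
    (hdim : Module.finrank ℂ V = 4)
    (g : V →ₗ[ℂ] V →ₗ[ℂ] ℂ)
    (hsymm : ∀ u v, g u v = g v u)
    (hnd : ∀ u, (∀ v, g u v = 0) → u = 0)
    (P : V →ₗ[ℂ] V)
    (hP : ∀ v, P (P v) = v)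
    (hPg : ∀ u v, g (P u) (P v) = - g u v)
    (W : Submodule ℂ V)
    (hWdim : Module.finrank ℂ W = 2)
    (hLag : ∀ u ∈ W, ∀ v ∈ W, g u (P v) = 0) :
    (∀ u ∈ W, (∀ v ∈ W, g u v = 0) → u = 0) ↔
      (W ⊓ LinearMap.ker (P - LinearMap.id) = ⊥ ∧
       W ⊓ LinearMap.ker (P + LinearMap.id) = ⊥) := by
  constructor
  · intro h
    constructor
    · rw [eq_bot_iff]
      rintro u ⟨hu, hk⟩
      have hk' : P u = u := by
        simpa [sub_eq_zero] using hk
      refine (Submodule.mem_bot ℂ).2 (h u hu fun v hv => ?_)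
      rw [hsymm, ← hk']
      exact hLag v hv u hu
    · rw [eq_bot_iff]
      rintro u ⟨hu, hk⟩
      have hk' : P u = -u := by
        simpa [add_eq_zero_iff_eq_neg] using hk
      refine (Submodule.mem_bot ℂ).2 (h u hu fun v hv => ?_)
      have h1 := hLag v hv u hu
      rw [hk', map_neg, neg_eq_zero] at h1
      rw [hsymm, h1]
  · rintro ⟨h1, h2⟩ u hu hort
    have hinj : Function.Injective P := fun a b hab => by
      rw [← hP a, hab, hP]
    have hN : LinearMap.BilinForm.Nondegenerate g :=
      ⟨hnd, fun y hy => hnd y fun v => by rw [hsymm]; exact hy v⟩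
    have hfr := LinearMap.BilinForm.finrank_orthogonal hN W
    have hle : W.map P ≤ LinearMap.BilinForm.orthogonal g W := by
      rintro _ ⟨w, hw, rfl⟩
      exact fun n hn => hLag n hn w hw
    have hmap : Module.finrank ℂ (W.map P) = 2 := by
      rw [← hWdim]
      exact (LinearEquiv.finrank_eq (Submodule.equivMapOfInjective P hinj W)).symm
    have heq := Submodule.eq_of_le_of_finrank_eq hle (by rw [hfr, hmap, hdim, hWdim])
    have hmem : u ∈ LinearMap.BilinForm.orthogonal g W := fun n hn => by
      have := hort n hn
      rw [hsymm] at this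
      exact this
    rw [← heq] at hmem
    obtain ⟨w, hw, rfl⟩ := hmem
    have e1 : P w + w ∈ W ⊓ LinearMap.ker (P - LinearMap.id) :=
      ⟨W.add_mem hu hw, by simp [hP, add_comm]⟩
    have e2 : P w - w ∈ W ⊓ LinearMap.ker (P + LinearMap.id) :=
      ⟨W.sub_mem hu hw, by simp [hP, add_comm]⟩
    rw [h1, Submodule.mem_bot] at e1
    rw [h2, Submodule.mem_bot] at e2
    have e3 : (2:ℂ) • P w = 0 := by
      rw [two_smul]
      calc P w + P w = (P w + w) + (P w - w) := by abel
        _ = 0 := by rw [e1, e2, add_zero]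
    exact (smul_eq_zero.1 e3).resolve_left two_ne_zero
end

section
/- Let V be a real vector space, g : V × V → ℝ a symmetric bilinear form, and P : V → V a linear map with P∘P = id and g(Pu,Pv) = −g(u,v) for all u,v ∈ V. Define R : V⁴ → ℝ by R(A,B,C,D) := g(A,C)g(B,D) − g(B,C)g(A,D) + g(A,PC)g(PB,D) − g(B,PC)g(PA,D) + 2 g(A,PB)g(PC,D). Let W ⊆ V be a subspace such that g(u,Pv) = 0 for all u,v ∈ W and such that the restriction of g to W is positive definite, and let e₁, e₂ ∈ W with g(e_i, e_j) = δ_ij span W. Then for all X, Y, Z ∈ W: R(PZ, X, PZ, Y) = −g(Z,Z)·g(X,Y) − 3·g(X,Z)·g(Y,Z); and consequently for every Z ∈ W with Z ≠ 0: R(PZ, e₁, PZ, e₁) + R(PZ, e₂, PZ, e₂) = −2 g(Z,Z) − 3( g(e₁,Z)² + g(e₂,Z)² ) < 0. -/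
/-- Curvature computation for the second variation of area of a space-like minimal Lagrangian
in the para-complex hyperbolic plane: for the constant para-holomorphic-curvature tensor `R`,
normal variations `PZ` along a space-like Lagrangian plane `W` give
`R(PZ,X,PZ,Y) = −g(Z,Z)g(X,Y) − 3g(X,Z)g(Y,Z)`, whose trace over an orthonormal basis of `W`
is strictly negative. -/
theorem stmt_14 {V : Type*} [AddCommGroup V] [Module ℝ V]
    (g : V →ₗ[ℝ] V →ₗ[ℝ] ℝ)
    (hsymm : ∀ u v, g u v = g v u)
    (P : V →ₗ[ℝ] V)
    (hP : ∀ v, P (P v) = v)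
    (hPg : ∀ u v, g (P u) (P v) = - g u v)
    (R : V → V → V → V → ℝ)
    (hR : ∀ A B C D, R A B C D =
      g A C * g B D - g B C * g A D + g A (P C) * g (P B) D - g B (P C) * g (P A) D +
        2 * g A (P B) * g (P C) D)
    (W : Submodule ℝ V)
    (hLag : ∀ u ∈ W, ∀ v ∈ W, g u (P v) = 0)
    (hpos : ∀ w ∈ W, w ≠ 0 → 0 < g w w)
    (e₁ e₂ : V) (he₁ : e₁ ∈ W) (he₂ : e₂ ∈ W)
    (hon : g e₁ e₁ = 1 ∧ g e₂ e₂ = 1 ∧ g e₁ e₂ = 0)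
    (hspan : Submodule.span ℝ {e₁, e₂} = W) :
    (∀ X ∈ W, ∀ Y ∈ W, ∀ Z ∈ W,
      R (P Z) X (P Z) Y = - g Z Z * g X Y - 3 * (g X Z * g Y Z)) ∧
    (∀ Z ∈ W, Z ≠ 0 →
      R (P Z) e₁ (P Z) e₁ + R (P Z) e₂ (P Z) e₂ =
        -2 * g Z Z - 3 * (g e₁ Z ^ 2 + g e₂ Z ^ 2) ∧
      R (P Z) e₁ (P Z) e₁ + R (P Z) e₂ (P Z) e₂ < 0) := by
  have key : ∀ X ∈ W, ∀ Y ∈ W, ∀ Z ∈ W,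
      R (P Z) X (P Z) Y = - g Z Z * g X Y - 3 * (g X Z * g Y Z) := by
    intro X hX Y hY Z hZ
    rw [hR, hP, hPg, hPg, hLag X hX Z hZ, hsymm (P Z) Z, hLag Z hZ Z hZ, hsymm Z X, hsymm Z Y]
    ring
  refine ⟨key, ?_⟩
  intro Z hZ hZ0
  obtain ⟨h1, h2, -⟩ := hon
  have h : R (P Z) e₁ (P Z) e₁ + R (P Z) e₂ (P Z) e₂ =
        -2 * g Z Z - 3 * (g e₁ Z ^ 2 + g e₂ Z ^ 2) := by
    rw [key e₁ he₁ e₁ he₁ Z hZ, key e₂ he₂ e₂ he₂ Z hZ, h1, h2]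
    ring
  refine ⟨h, ?_⟩
  rw [h]
  have := hpos Z hZ hZ0
  nlinarith [sq_nonneg (g e₁ Z), sq_nonneg (g e₂ Z)]
end
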